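/- arXiv:2502.12278 — 4 statements merged into one kernel-verified Lean document; each statement's English description precedes it below -/
import Mathlib

section
/- Let g : ℕ → ℕ → ℕ be defined by g(0, m) = 1 if m = 0 and 0 otherwise; g(l, 0) = 1 for l > 0; g(l, m) = g(l−1, m) + m·g(l−1, m−1) for l, m > 0. Define f(m, n) := ∑_{l=0}^{n} (−1)^{n−l} · (n choose l) · g(l, m) in ℤ. Then for all m, n ∈ ℕ, f(m, n) equals the number of bijections between an m-element set and an n-element set, i.e., f(m, n) = n! if m = n and f(m, n) = 0 otherwise. -/
/-- The auxiliary recursive function `g` compiled by Crane2 for the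
bijection-counting problem: `g 0 0 = 1`, `g 0 (m+1) = 0`, `g (l+1) 0 = 1`,
and `g (l+1) (m+1) = g l (m+1) + (m+1) * g l m`. -/
def g : ℕ → ℕ → ℕ
  | 0, 0 => 1
  | 0, _ + 1 => 0
  | _ + 1, 0 => 1
  | l + 1, m + 1 => g l (m + 1) + (m + 1) * g l m

/-- The main function `f` compiled by Crane2 for the bijection-counting
problem: `f m n = ∑_{l=0}^{n} (−1)^{n−l} (n choose l) g(l, m)`. -/
def f (m n : ℕ) : ℤ :=
  ∑ l ∈ Finset.range (n + 1), (-1 : ℤ) ^ (n - l) * (n.choose l : ℤ) * (g l m : ℤ)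

theorem g_eq_factorial_mul_choose (l m : ℕ) : g l m = m.factorial * l.choose m := by
  induction l generalizing m with
  | zero => cases m <;> simp [g]
  | succ l ih =>
    cases m with
    | zero => simp [g]
    | succ m =>
      rw [g, ih, ih, Nat.choose_succ_succ, Nat.factorial_succ]
      ring

/-- Correctness of the compiled solution: `f m n` equals the number of
bijections between an `m`-element set and an `n`-element set, i.e. `n!` when
`m = n` and `0` otherwise. -/
theorem f_counts_bijections (m n : ℕ) :
    f m n = if m = n then (n.factorial : ℤ) else 0 := by
  have h := fwdDiff_iter_eq_sum_shift (1 : ℕ) (fun x : ℕ ↦ (x.choose m : ℤ)) n 0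
  rw [fwdDiff_iter_choose_zero] at h
  have hf : f m n = m.factorial * if n = m then (1 : ℤ) else 0 := by
    rw [h, f, Finset.mul_sum]
    refine Finset.sum_congr rfl fun l _ ↦ ?_
    simp only [g_eq_factorial_mul_choose, smul_eq_mul, zero_add, mul_one]
    push_cast
    ring
  rw [hf]
  by_cases hmn : m = n
  · simp [hmn]
  · simp [hmn, Ne.symm hmn]
end

section
/- Let Γ and Δ be finite sets with |Γ| = m and |Δ| = n. Then ∑ (−1)^{|Γ| − |S|}, where the sum ranges over all triples (R, Z, S) with R ⊆ Γ × Δ and Z, S ⊆ Γ satisfying: (i) Z = Γ; (ii) for all x ∈ Γ and y ∈ Δ, x ∈ Z or (x, y) ∉ R; (iii) for all x ∈ Γ, x ∈ S or x ∈ Z; and (iv) for all x ∈ Γ and y ∈ Δ, x ∈ S or (x, y) ∉ R, equals (2^n − 1)^m, the number of relations R ⊆ Γ × Δ in which every x ∈ Γ is related to some y ∈ Δ. -/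
/-- Given `S`, the relations all of whose left endpoints lie in `S` are the subsets of `S × Δ`. -/
lemma card_filter_forall_mem_or_notMem {Γ Δ : Type*} [Fintype Γ] [Fintype Δ]
    [DecidableEq Γ] [DecidableEq Δ] (S : Finset Γ) :
    (Finset.univ.filter fun R : Finset (Γ × Δ) => ∀ x y, x ∈ S ∨ (x, y) ∉ R).card =
      (2 ^ Fintype.card Δ) ^ S.card := by
  have h : (Finset.univ.filter fun R : Finset (Γ × Δ) => ∀ x y, x ∈ S ∨ (x, y) ∉ R) =
      (S ×ˢ (Finset.univ : Finset Δ)).powerset := by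
    ext R
    simp only [Finset.mem_filter_univ, Finset.mem_powerset, Finset.subset_iff, Prod.forall,
      Finset.mem_product, Finset.mem_univ, and_true]
    exact forall₂_congr fun x y => by tauto
  rw [h, Finset.card_powerset, Finset.card_product, Finset.card_univ, mul_comm, pow_mul]


/-- Correctness of Skolemization for `∀x ∈ Γ. ∃y ∈ Δ. P(x, y)`: the weighted
model count of the Skolemized sentence (each model `(R, Z, S)` weighted by
`(−1)^{|Γ| − |S|}`) equals `(2^n − 1)^m`, the number of relations `R ⊆ Γ × Δ`
in which every `x ∈ Γ` is related to some `y ∈ Δ`. -/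
theorem skolemization_correct (Γ Δ : Type*) [Fintype Γ] [Fintype Δ]
    [DecidableEq Γ] [DecidableEq Δ] (m n : ℕ)
    (hΓ : Fintype.card Γ = m) (hΔ : Fintype.card Δ = n) :
    (∑ R : Finset (Γ × Δ), ∑ Z : Finset Γ, ∑ S : Finset Γ,
        if Z = Finset.univ ∧
            (∀ x : Γ, ∀ y : Δ, x ∈ Z ∨ (x, y) ∉ R) ∧
            (∀ x : Γ, x ∈ S ∨ x ∈ Z) ∧
            (∀ x : Γ, ∀ y : Δ, x ∈ S ∨ (x, y) ∉ R) then
          (-1 : ℤ) ^ (Fintype.card Γ - S.card)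
        else 0) =
      ((2 ^ n - 1) ^ m : ℤ) := by
  subst hΓ hΔ
  have hZ (R : Finset (Γ × Δ)) : (∑ Z : Finset Γ, ∑ S : Finset Γ,
        if Z = Finset.univ ∧
            (∀ x : Γ, ∀ y : Δ, x ∈ Z ∨ (x, y) ∉ R) ∧
            (∀ x : Γ, x ∈ S ∨ x ∈ Z) ∧
            (∀ x : Γ, ∀ y : Δ, x ∈ S ∨ (x, y) ∉ R) then
          (-1 : ℤ) ^ (Fintype.card Γ - S.card)
        else 0) =
      ∑ S : Finset Γ, if ∀ x : Γ, ∀ y : Δ, x ∈ S ∨ (x, y) ∉ R then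
        (-1 : ℤ) ^ (Fintype.card Γ - S.card) else 0 := by
    rw [Finset.sum_eq_single_of_mem Finset.univ (Finset.mem_univ _)]
    · simp
    · intro Z _ hne
      simp [hne]
  simp_rw [hZ]
  rw [Finset.sum_comm, sub_eq_add_neg, ← Fintype.sum_pow_mul_eq_add_pow Γ]
  refine Finset.sum_congr rfl fun S _ => ?_
  rw [← Finset.sum_filter, Finset.sum_const, card_filter_forall_mem_or_notMem, nsmul_eq_mul]
  push_cast
  rfl
end

section
/- Let Δ be a finite set with |Δ| = n. Then ∑_{R} ∑_{S} (−1)^{n − |S|} = n^n, where R ranges over all subsets of Δ × Δ with |R| = n, and for each such R, S ranges over all subsets of Δ such that for every x ∉ S and every y ∈ Δ, (x, y) ∉ R. -/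
/-- The signed sum over all supersets of `D` detects whether `D` is everything. -/
theorem sum_superset_neg_one_pow_card_compl {α : Type*} [Fintype α] [DecidableEq α]
    (D : Finset α) :
    (∑ S : Finset α, if D ⊆ S then (-1 : ℤ) ^ (Fintype.card α - S.card) else 0) =
      if D = Finset.univ then 1 else 0 := by
  rw [← (compl_bijective (α := Finset α)).sum_comp]
  have h := Finset.sum_powerset_neg_one_pow_card (x := Dᶜ)
  simp only [Finset.compl_eq_empty_iff] at h
  rw [← h, ← Finset.sum_filter]
  refine Finset.sum_congr ?_ fun T _ => ?_
  · ext T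
    simp [Finset.subset_compl_comm]
  · rw [← Finset.card_compl, compl_compl]

/-- The total relations on `α` with `Fintype.card α` pairs are the graphs of the functions
`α → α`. -/
theorem card_total_relations_of_card_eq (α : Type*) [Fintype α] [DecidableEq α] :
    (Finset.univ.filter fun R : Finset (α × α) =>
        R.card = Fintype.card α ∧ R.image Prod.fst = Finset.univ).card =
      Fintype.card α ^ Fintype.card α := by
  have card_graph (f : α → α) :
      (Finset.univ.image fun x => (x, f x)).card = Fintype.card α :=
    Finset.card_image_of_injective _ fun _ _ h => congrArg Prod.fst h
  rw [← Fintype.card_fun, ← Finset.card_univ (α := α → α)]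
  symm
  refine Finset.card_bij (fun f _ => Finset.univ.image fun x => (x, f x)) ?_ ?_ ?_
  · intro f _
    simp only [Finset.mem_filter, Finset.mem_univ, true_and]
    refine ⟨card_graph f, ?_⟩
    ext x
    simp
  · intro f _ g _ h
    funext x
    have hx : (x, f x) ∈ Finset.univ.image fun x => (x, g x) := by
      rw [← h]
      simp
    symm
    simpa using hx
  · intro R hR
    simp only [Finset.mem_filter, Finset.mem_univ, true_and] at hR
    have total (x : α) : ∃ y, (x, y) ∈ R := by
      have hx : x ∈ R.image Prod.fst := hR.2 ▸ Finset.mem_univ x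
      simpa using hx
    choose f hf using total
    refine ⟨f, Finset.mem_univ f, Finset.eq_of_subset_of_card_le ?_ ?_⟩
    · simpa [Finset.image_subset_iff] using hf
    · rw [card_graph, hR.1]

/-- The UFO² + CC formulation of the function-counting benchmark: the weighted
model count of `(∀x,y ∈ Δ. S(x) ∨ ¬P(x,y)) ∧ (|P| = |Δ|)`, with each model
`(R, S)` weighted by `(−1)^{n − |S|}`, equals `n^n`. -/
theorem ufo_cc_function_count (Δ : Type*) [Fintype Δ] [DecidableEq Δ] (n : ℕ)
    (hΔ : Fintype.card Δ = n) :
    (∑ R : Finset (Δ × Δ), ∑ S : Finset Δ,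
        if R.card = n ∧ (∀ x : Δ, x ∉ S → ∀ y : Δ, (x, y) ∉ R) then
          (-1 : ℤ) ^ (n - S.card)
        else 0) =
      (n : ℤ) ^ n := by
  subst hΔ
  have inner (R : Finset (Δ × Δ)) :
      (∑ S : Finset Δ,
        if R.card = Fintype.card Δ ∧ (∀ x : Δ, x ∉ S → ∀ y : Δ, (x, y) ∉ R) then
          (-1 : ℤ) ^ (Fintype.card Δ - S.card)
        else 0) =
      if R.card = Fintype.card Δ ∧ R.image Prod.fst = Finset.univ then 1 else 0 := by
    have domain_subset (S : Finset Δ) :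
        (∀ x : Δ, x ∉ S → ∀ y : Δ, (x, y) ∉ R) ↔ R.image Prod.fst ⊆ S := by
      simp only [Finset.image_subset_iff, Prod.forall]
      exact ⟨fun h x y hxy => by_contra fun hx => h x hx y hxy,
        fun h x hx y hxy => hx (h x y hxy)⟩
    by_cases hR : R.card = Fintype.card Δ
    · simp only [hR, true_and, domain_subset]
      exact sum_superset_neg_one_pow_card_compl _
    · simp [hR]
  rw [Finset.sum_congr rfl fun R _ => inner R, Finset.sum_boole,
    card_total_relations_of_card_eq, Nat.cast_pow]
end

section
/- Let Δ be a finite set with |Δ| = n. Then ∑_{R} ∑_{(A,B)} (−1)^{(n − |A|) + (n − |B|)} = n!, where R ranges over all subsets of Δ × Δ with |R| = n, and for each such R, (A, B) ranges over all pairs of subsets of Δ such that: for every x ∉ A and every y ∈ Δ, (x, y) ∉ R; and for every y ∉ B and every x ∈ Δ, (x, y) ∉ R. -/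
open Finset in
/-- The signed count of the supersets of `S` detects whether `S` is everything. -/
theorem sum_neg_one_pow_card_compl_of_subset {α : Type*} [Fintype α] [DecidableEq α]
    (S : Finset α) :
    (∑ A : Finset α, if S ⊆ A then (-1 : ℤ) ^ (Fintype.card α - A.card) else 0) =
      if S = univ then 1 else 0 := by
  have h := sum_powerset_neg_one_pow_card (x := Sᶜ)
  simp only [compl_eq_empty_iff] at h
  rw [← h, ← sum_filter]
  refine sum_nbij' compl compl ?_ ?_ (by simp) (by simp) ?_
  · intro A hA
    simpa using hA
  · intro A hA
    simpa [subset_compl_comm] using hA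
  · intro A _
    rw [card_compl]

open Finset in
/-- The relations of size `|α|` that are total and surjective are the graphs of permutations. -/
theorem card_filter_image_fst_snd_eq_univ (α : Type*) [Fintype α] [DecidableEq α] :
    (univ.filter fun R : Finset (α × α) => R.card = Fintype.card α ∧
      R.image Prod.fst = univ ∧ R.image Prod.snd = univ).card = (Fintype.card α).factorial := by
  have graph_card (f : α → α) :
      (univ.image fun x => (x, f x)).card = Fintype.card α :=
    card_image_of_injective _ fun x y h => congrArg Prod.fst h
  rw [← Fintype.card_perm, ← card_univ (α := Equiv.Perm α)]
  symm
  refine card_bij (fun (e : Equiv.Perm α) _ => univ.image fun x => (x, e x)) ?_ ?_ ?_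
  · intro e _
    simp only [mem_filter, mem_univ, true_and]
    refine ⟨graph_card e, ?_, ?_⟩
    · ext x
      simp
    · ext y
      simpa using e.surjective y
  · intro e _ e' _ h
    ext x
    have hx : (x, e x) ∈ univ.image fun x => (x, e' x) := by
      rw [← h]
      exact mem_image_of_mem _ (mem_univ x)
    simpa [eq_comm] using hx
  · intro R hR
    simp only [mem_filter, mem_univ, true_and] at hR
    obtain ⟨hcard, hfst, hsnd⟩ := hR
    have hex (x : α) : ∃ y, (x, y) ∈ R := by
      have hx : x ∈ R.image Prod.fst := hfst ▸ mem_univ x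
      simpa using hx
    choose f hf using hex
    have hgraph : (univ.image fun x => (x, f x)) = R := by
      refine eq_of_subset_of_card_le ?_ (by rw [hcard, graph_card])
      intro p hp
      obtain ⟨x, -, rfl⟩ := mem_image.1 hp
      exact hf x
    have hsurj : Function.Surjective f := by
      intro y
      have hy : y ∈ R.image Prod.snd := hsnd ▸ mem_univ y
      rw [← hgraph] at hy
      simpa using hy
    exact ⟨Equiv.ofBijective f (Finite.surjective_iff_bijective.1 hsurj), mem_univ _, hgraph⟩

/-- The UFO² + CC formulation of the bijection-counting benchmark: the weighted
model count of `(∀x,y ∈ Δ. R₀(x) ∨ ¬P(x,y)) ∧ (∀x,y ∈ Δ. S₀(x) ∨ ¬P(y,x)) ∧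
(|P| = |Δ|)`, with each model `(R, (A, B))` weighted by
`(−1)^{(n − |A|) + (n − |B|)}`, equals `n!`. -/
theorem ufo_cc_bijection_count (Δ : Type*) [Fintype Δ] [DecidableEq Δ] (n : ℕ)
    (hΔ : Fintype.card Δ = n) :
    (∑ R : Finset (Δ × Δ), ∑ A : Finset Δ, ∑ B : Finset Δ,
        if R.card = n ∧ (∀ x : Δ, x ∉ A → ∀ y : Δ, (x, y) ∉ R) ∧
            (∀ y : Δ, y ∉ B → ∀ x : Δ, (x, y) ∉ R) then
          (-1 : ℤ) ^ ((n - A.card) + (n - B.card))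
        else 0) =
      (n.factorial : ℤ) := by
  subst hΔ
  rw [← card_filter_image_fst_snd_eq_univ Δ, Finset.card_filter, Nat.cast_sum]
  refine Finset.sum_congr rfl fun R _ => ?_
  have hfst (A : Finset Δ) :
      (∀ x : Δ, x ∉ A → ∀ y : Δ, (x, y) ∉ R) ↔ R.image Prod.fst ⊆ A := by
    simp only [Finset.subset_iff, Finset.mem_image, Prod.exists]
    grind
  have hsnd (B : Finset Δ) :
      (∀ y : Δ, y ∉ B → ∀ x : Δ, (x, y) ∉ R) ↔ R.image Prod.snd ⊆ B := by
    simp only [Finset.subset_iff, Finset.mem_image, Prod.exists]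
    grind
  simp only [hfst, hsnd]
  by_cases hR : R.card = Fintype.card Δ
  · simp only [hR, true_and, pow_add]
    have hprod := congrArg₂ (· * ·)
      (sum_neg_one_pow_card_compl_of_subset (R.image Prod.fst))
      (sum_neg_one_pow_card_compl_of_subset (R.image Prod.snd))
    simp only [Finset.sum_mul_sum, ite_zero_mul_ite_zero, mul_one] at hprod
    rw [hprod]
    push_cast
    rfl
  · simp [hR]
end
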